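/- Assume the operators L, B₃, …, B_{2g+1} commute. Then the map Ω → ℂ^{2g}, t ↦ (λ₄(β(t)), λ₆(β(t)), …, λ_{4g+2}(β(t))) = ρ_g(β(t)), is constant on Ω; moreover, if μ₄, …, μ_{4g+2} ∈ ℂ are constants such that, identically on Ω, ξ·𝐜₂(ξ)² + 2ξ·𝐜₃(ξ)(1 − 𝐜₁(ξ)) + 4(1 + v₂ξ)(1 − 𝐜₁(ξ))² = 4 + 4Σ_{i=1}^{2g} μ_{2i+2} ξ^{i+1} as polynomials in ξ, where 𝐜₁(ξ) = (1/2)Σ_{i=1}^{g} v_{2i} ξⁱ, 𝐜₂(ξ) = (1/2)Σ_{i=1}^{g} (∂₁v_{2i}) ξⁱ, 𝐜₃(ξ) = (1/2)Σ_{i=1}^{g} (∂₁²v_{2i}) ξⁱ, then λ_{2m+2}(β) ≡ μ_{2m+2} on Ω for every 1 ≤ m ≤ 2g. -/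

import Mathlib

open MvPolynomial

noncomputable section

/-- B_g = ℂ[b_{i,j} : i ∈ {1,2,3}, j odd, 1 ≤ j ≤ 2g−1], as a polynomial ring in 3g variables;
the variable (i, m) : Fin 3 × Fin g stands for b_{i+1, 2m+1}. -/
abbrev Bg (g : ℕ) : Type := MvPolynomial (Fin 3 × Fin g) ℂ

/-- `bb g i m` is the variable b_{i, 2m−1} (zero if i ∉ {1,2,3} or m ∉ {1,…,g}). -/
noncomputable def bb (g : ℕ) (i m : ℕ) : Bg g :=
  if h : 1 ≤ i ∧ i ≤ 3 ∧ 1 ≤ m ∧ m ≤ g then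
    MvPolynomial.X (⟨i - 1, by omega⟩, ⟨m - 1, by omega⟩) else 0

/-- `bv g i j` is the variable b_{i,j} for odd j (zero for j > 2g−1). -/
noncomputable def bv (g : ℕ) (i j : ℕ) : Bg g :=
  if Odd j then bb g i ((j + 1) / 2) else 0

/-- `Qg g a c` is p_{2a−1, 2c−1} for 1 ≤ a ≤ c, by the elimination recursion. -/
noncomputable def Qg (g : ℕ) : ℕ → ℕ → Bg g
  | 0, _ => 0
  | 1, c => 2 * bb g 1 c
  | 2, c => 6 * bb g 1 1 * bb g 1 c - bb g 3 c + 6 * bb g 1 (c + 1)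
  | 3, c => bb g 3 1 * bb g 1 c - bb g 2 1 * bb g 2 c + bb g 1 1 * bb g 3 c
      - 2 * (4 * bb g 1 1 ^ 2 + bb g 1 2) * bb g 1 c
      + 10 * bb g 1 1 * bb g 1 (c + 1) - 2 * bb g 3 (c + 1) + 10 * bb g 1 (c + 2)
  | (a + 4), c => 2 * (if c + 1 ≤ g then Qg g (a + 3) (c + 1) else 0)
      - (if c + 2 ≤ g then Qg g (a + 2) (c + 2) else 0)
      - 8 * bb g 1 1 * bb g 1 (a + 2) * bb g 1 c - 2 * bb g 1 c * bb g 1 (a + 3)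
      - 2 * bb g 1 (a + 2) * bb g 1 (c + 1) + bb g 1 (a + 2) * bb g 3 c
      - bb g 2 (a + 2) * bb g 2 c + bb g 3 (a + 2) * bb g 1 c

/-- `pp g k l` is p_{k,l} for odd k, l (zero if k > 2g−1 or l > 2g−1). -/
noncomputable def pp (g : ℕ) (k l : ℕ) : Bg g :=
  if Odd k ∧ Odd l ∧ k ≤ 2 * g - 1 ∧ l ≤ 2 * g - 1 then
    if k ≤ l then Qg g ((k + 1) / 2) ((l + 1) / 2) else Qg g ((l + 1) / 2) ((k + 1) / 2)
  else 0

/-- 𝐛ᵢ(ξ) = Σ_{m=1}^{g} b_{i,2m−1} ξᵐ ∈ B_g[ξ]. -/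
noncomputable def Bcoef (g i : ℕ) : Polynomial (Bg g) :=
  ∑ m ∈ Finset.Icc 1 g, Polynomial.C (bb g i m) * Polynomial.X ^ m

/-- The polynomial ξ𝐛₂(ξ)² + 2ξ𝐛₃(ξ)(1 − 𝐛₁(ξ)) + 4(1 + 2b_{1,1}ξ)(1 − 𝐛₁(ξ))². -/
noncomputable def Fg (g : ℕ) : Polynomial (Bg g) :=
  Polynomial.X * (Bcoef g 2) ^ 2 + 2 * Polynomial.X * Bcoef g 3 * (1 - Bcoef g 1)
    + 4 * (1 + 2 * Polynomial.C (bb g 1 1) * Polynomial.X) * (1 - Bcoef g 1) ^ 2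

/-- `lam g m` is λ_{2m+2}, defined by 4λ_{2m+2} = coefficient of ξ^{m+1} in `Fg g`. -/
noncomputable def lam (g m : ℕ) : Bg g := ((1 : ℂ) / 4) • ((Fg g).coeff (m + 1))

/-- The partial derivative ∂_{2m−1} with respect to the m-th coordinate t_{2m−1} of ℂᵍ
(zero for m > g, in accordance with the convention ∂_{2g+1} = 0). -/
noncomputable def pd (g : ℕ) (m : ℕ) (f : (Fin g → ℂ) → ℂ) : (Fin g → ℂ) → ℂ :=
  fun t => if h : 1 ≤ m ∧ m - 1 < g then fderiv ℂ f t (Pi.single (⟨m - 1, h.2⟩ : Fin g) 1) else 0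

/-- L f = ∂₁²f − v₂·f (here `v m` denotes v_{2m}). -/
noncomputable def Lfun (g : ℕ) (v : ℕ → (Fin g → ℂ) → ℂ) (f : (Fin g → ℂ) → ℂ) :
    (Fin g → ℂ) → ℂ :=
  pd g 1 (pd g 1 f) - v 1 * f

/-- B_{2k+1} f = ∂_{2k−1}∂₁²f − (1/2)(v₂·∂_{2k−1}f + ∂_{2k−1}(v₂·f))
− (1/4)(v_{2k}·∂₁f + ∂₁(v_{2k}·f)) − ∂_{2k+1}f (with ∂_{2g+1} = 0). -/
noncomputable def Bfun (g : ℕ) (v : ℕ → (Fin g → ℂ) → ℂ) (k : ℕ) (f : (Fin g → ℂ) → ℂ) :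
    (Fin g → ℂ) → ℂ :=
  pd g k (pd g 1 (pd g 1 f))
    - ((1 : ℂ) / 2) • (v 1 * pd g k f + pd g k (v 1 * f))
    - ((1 : ℂ) / 4) • (v k * pd g 1 f + pd g 1 (v k * f)) - pd g (k + 1) f

/-- The operators L, B₃, …, B_{2g+1} commute (on holomorphic functions on Ω). -/
def OpsCommute (g : ℕ) (Ω : Set (Fin g → ℂ)) (v : ℕ → (Fin g → ℂ) → ℂ) : Prop :=
  ∀ f : (Fin g → ℂ) → ℂ, AnalyticOnNhd ℂ f Ω →
    ∀ k l, 1 ≤ k → k ≤ g → 1 ≤ l → l ≤ g →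
      Set.EqOn (Lfun g v (Bfun g v k f)) (Bfun g v k (Lfun g v f)) Ω ∧
      Set.EqOn (Bfun g v k (Bfun g v l f)) (Bfun g v l (Bfun g v k f)) Ω

/-- 𝐛ᵢ(ξ) evaluated at t : the polynomial (1/2)Σ_{m=1}^{g} (∂₁^{i−1}v_{2m})(t) ξᵐ. -/
noncomputable def cpoly (g : ℕ) (v : ℕ → (Fin g → ℂ) → ℂ) (i : ℕ) (t : Fin g → ℂ) :
    Polynomial ℂ :=
  ∑ m ∈ Finset.Icc 1 g, Polynomial.C (((1 : ℂ) / 2) * ((pd g 1)^[i - 1] (v m)) t)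
    * Polynomial.X ^ m

/-- The generating identity: for all t ∈ Ω,
ξ𝐛₂(ξ)² + 2ξ𝐛₃(ξ)(1 − 𝐛₁(ξ)) + 4(1 + v₂ξ)(1 − 𝐛₁(ξ))² = 4 + 4Σ_{i=1}^{2g} μ_{2i+2}ξ^{i+1}
as polynomials in ξ (here `μ i` denotes μ_{2i+2}). -/
def GenIdent (g : ℕ) (Ω : Set (Fin g → ℂ)) (v : ℕ → (Fin g → ℂ) → ℂ) (μ : ℕ → ℂ) : Prop :=
  ∀ t ∈ Ω,
    Polynomial.X * (cpoly g v 2 t) ^ 2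
      + 2 * Polynomial.X * cpoly g v 3 t * (1 - cpoly g v 1 t)
      + 4 * (1 + Polynomial.C (v 1 t) * Polynomial.X) * (1 - cpoly g v 1 t) ^ 2
    = 4 + 4 * ∑ i ∈ Finset.Icc 1 (2 * g), Polynomial.C (μ i) * Polynomial.X ^ (i + 1)

/-- β_{i,j} = (1/2)∂₁^{i−1} v_{j+1} for j = 2m−1 (here `v m` denotes v_{2m}). -/
noncomputable def betaf (g : ℕ) (v : ℕ → (Fin g → ℂ) → ℂ) (i m : ℕ) : (Fin g → ℂ) → ℂ :=
  fun t => ((1 : ℂ) / 2) * ((pd g 1)^[i - 1] (v m)) t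

/-- Evaluation of a polynomial P ∈ B_g at the point β(t). -/
noncomputable def evalBeta (g : ℕ) (v : ℕ → (Fin g → ℂ) → ℂ) (t : Fin g → ℂ) (P : Bg g) : ℂ :=
  MvPolynomial.eval (fun w : Fin 3 × Fin g => betaf g v ((w.1 : ℕ) + 1) ((w.2 : ℕ) + 1) t) P

/-- Multiplication by a nonzero natural number is injective on a complex algebra. -/
lemma eq_zero_of_natCast_mul_eq_zero {A : Type*} [CommRing A] [Algebra ℂ A] (n : ℕ) (hn : n ≠ 0)
    {y : A} (h : (n : A) * y = 0) : y = 0 := by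
  have e : algebraMap ℂ A (1 / n) * (n : A) = 1 := by
    rw [← map_natCast (algebraMap ℂ A) n, ← map_mul]
    have : (n : ℂ) ≠ 0 := Nat.cast_ne_zero.2 hn
    rw [one_div_mul_cancel this, map_one]
  linear_combination (-y) * e + algebraMap ℂ A (1 / n) * h

/-- A differential operator of order at most three in one derivation admitting a coordinate
vanishes only if its coefficients vanish. -/
lemma coeff_eq_zero_of_operator_eq_zero {A : Type*} [CommRing A] [Algebra ℂ A]
    (D : Derivation ℂ A A) {x : A} (hx : D x = 1) {a₀ a₁ a₂ a₃ : A}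
    (h : ∀ f, a₃ * D (D (D f)) + a₂ * D (D f) + a₁ * D f + a₀ * f = 0) :
    a₀ = 0 ∧ a₁ = 0 ∧ a₂ = 0 ∧ a₃ = 0 := by
  have h0 := h 1
  have h1 := h x
  have h2 := h (x * x)
  have h3 := h (x * (x * x))
  simp only [Derivation.leibniz, Derivation.map_one_eq_zero, map_zero, smul_eq_mul, hx, mul_one,
    mul_zero, map_add, add_zero, zero_add] at h0 h1 h2 h3
  subst h0
  simp only [zero_mul, add_zero] at h1 h2 h3
  subst h1
  have e2 : a₂ = 0 := eq_zero_of_natCast_mul_eq_zero 2 two_ne_zero (by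
    push_cast; linear_combination h2)
  subst e2
  refine ⟨rfl, rfl, rfl, eq_zero_of_natCast_mul_eq_zero 6 (by norm_num) ?_⟩
  push_cast
  linear_combination h3

/-- Consequences of the commutation of a Schrödinger operator with one third-order operator. -/
lemma lax_first {A : Type*} [CommRing A] [Algebra ℂ A] (D P R : Derivation ℂ A A)
    (hP : ∀ f, P (D f) = D (P f)) (hR : ∀ f, R (D f) = D (R f)) {x : A} (hx : D x = 1) (u w : A)
    (L B : A → A) (hL : ∀ f, L f = D (D f) - u * f)
    (hB : ∀ f, B f = 4 * P (D (D f)) - 2 * (u * P f + P (u * f)) - (w * D f + D (w * f)) - 4 * R f)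
    (h : ∀ f, L (B f) = B (L f)) :
    P u = D w ∧ 4 * R u = D (D (D w)) - 4 * (u * D w) - 2 * (w * D u) := by
  have four (Q : Derivation ℂ A A) : Q 4 = 0 := by exact_mod_cast Q.map_natCast 4
  have two (Q : Derivation ℂ A A) : Q 2 = 0 := by exact_mod_cast Q.map_natCast 2
  obtain ⟨h0, -, h2, -⟩ := coeff_eq_zero_of_operator_eq_zero D hx (a₃ := 0)
    (a₂ := 4 * (P u - D w)) (a₁ := 4 * (D (P u) - D (D w)))
    (a₀ := 2 * D (D (P u)) - 4 * (u * P u) - 2 * (w * D u) - D (D (D w)) - 4 * R u) (fun f => by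
      have := h f
      simp only [hL, hB, Derivation.leibniz, smul_eq_mul, map_sub, map_add, map_zero,
        two, four, hP, hR] at this
      linear_combination this)
  have e : P u = D w := by
    have := eq_zero_of_natCast_mul_eq_zero (A := A) 4 (by norm_num) (y := P u - D w)
      (by exact_mod_cast h2)
    linear_combination this
  refine ⟨e, ?_⟩
  rw [e] at h0
  linear_combination -h0

/-- Consequences of the commutation of two third-order operators which commute with the same
Schrödinger operator. -/
lemma lax_second {A : Type*} [CommRing A] [Algebra ℂ A] (D P R S T : Derivation ℂ A A)
    (hP : ∀ f, P (D f) = D (P f)) (hR : ∀ f, R (D f) = D (R f))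
    (hS : ∀ f, S (D f) = D (S f)) (hT : ∀ f, T (D f) = D (T f))
    (hSP : ∀ f, S (P f) = P (S f)) (hSR : ∀ f, R (S f) = S (R f))
    (hTP : ∀ f, T (P f) = P (T f)) (hTR : ∀ f, T (R f) = R (T f))
    {x : A} (hx : D x = 1) (u w y : A) (hu : P u = D w) (hu' : S u = D y)
    (L B C : A → A) (hL : ∀ f, L f = D (D f) - u * f)
    (hB : ∀ f, B f = 4 * P (D (D f)) - 2 * (u * P f + P (u * f)) - (w * D f + D (w * f)) - 4 * R f)
    (hC : ∀ f, C f = 4 * S (D (D f)) - 2 * (u * S f + S (u * f)) - (y * D f + D (y * f)) - 4 * T f)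
    (hLB : ∀ f, L (B f) = B (L f)) (hLC : ∀ f, L (C f) = C (L f))
    (hBC : ∀ f, B (C f) = C (B f)) :
    P y = S w ∧ 2 * (R y - T w) = y * D w - w * D y := by
  have four (Q : Derivation ℂ A A) : Q 4 = 0 := by exact_mod_cast Q.map_natCast 4
  have two (Q : Derivation ℂ A A) : Q 2 = 0 := by exact_mod_cast Q.map_natCast 2
  have hB' : ∀ f, B f = 4 * P (L f) + (D w * f - 2 * (w * D f) - 4 * R f) := fun f => by
    simp only [hL, hB, Derivation.leibniz, smul_eq_mul, map_sub, hu]; ring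
  have hC' : ∀ f, C f = 4 * S (L f) + (D y * f - 2 * (y * D f) - 4 * T f) := fun f => by
    simp only [hL, hC, Derivation.leibniz, smul_eq_mul, map_sub, hu']; ring
  have key : ∀ f, (4 * (D (P y - S w) * L f - 2 * ((P y - S w) * D (L f)))) +
      (4 * (w * D y - y * D w) + 8 * (R y - T w)) * D f
      + (2 * (y * D (D w) - w * D (D y)) + 4 * (T (D w) - R (D y))) * f = 0 := fun f => by
    have := hBC f
    rw [hB' (C f), hC' (B f), hLB, hLC, hB' (L f), hC' (L f), hB' f, hC' f] at this
    generalize L (L f) = m at this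
    generalize L f = l at this ⊢
    simp only [Derivation.leibniz, smul_eq_mul, map_sub, map_add, two, four, hP, hR, hS, hT, hSP,
      hSR, hTP, hTR] at this ⊢
    linear_combination this
  have hw : P y - S w = 0 := by
    obtain ⟨-, -, -, h⟩ := coeff_eq_zero_of_operator_eq_zero D hx
      (a₃ := -8 * (P y - S w)) (a₂ := 4 * D (P y - S w))
      (a₁ := 8 * (P y - S w) * u + (4 * (w * D y - y * D w) + 8 * (R y - T w)))
      (a₀ := -4 * D (P y - S w) * u + 8 * (P y - S w) * D u
        + (2 * (y * D (D w) - w * D (D y)) + 4 * (T (D w) - R (D y))))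
      (fun f => by
        have := key f
        simp only [hL, Derivation.leibniz, smul_eq_mul, map_sub] at this ⊢
        linear_combination this)
    refine eq_zero_of_natCast_mul_eq_zero 8 (by norm_num) ?_
    push_cast
    linear_combination -h
  simp only [hw, map_zero, zero_mul, mul_zero, sub_zero, zero_add] at key
  obtain ⟨-, h, -⟩ := coeff_eq_zero_of_operator_eq_zero D hx (a₃ := 0) (a₂ := 0) (fun f => by
    have := key f
    rw [zero_mul, zero_mul, zero_add, zero_add]; exact this)
  refine ⟨sub_eq_zero.1 hw, sub_eq_zero.1 (eq_zero_of_natCast_mul_eq_zero 4 (by norm_num) ?_)⟩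
  push_cast
  linear_combination h

/-- The generating function of the (rescaled) parameters, in a differential ring. -/
def genW {A : Type*} [CommRing A] (g : ℕ) (V : ℕ → A) (z : A) : A :=
  2 - ∑ k ∈ Finset.range g, z ^ (k + 1) * V (k + 1)

/-- Four times the value at `z` of the polynomial whose coefficients are first integrals. -/
def genF {A : Type*} [CommRing A] [Algebra ℂ A] (D : Derivation ℂ A A) (u z W : A) : A :=
  z * D W ^ 2 - 2 * z * D (D W) * W + 4 * (1 + u * z) * W ^ 2

/-- Commutation of the operators makes `genF` constant for all derivations. -/
lemma derivation_genF_eq_zero {A : Type*} [CommRing A] [Algebra ℂ A] {g : ℕ}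
    (d : ℕ → Derivation ℂ A A) (hd : ∀ k l f, d k (d l f) = d l (d k f)) (hdg : d (g + 1) = 0)
    {x : A} (hx : d 1 x = 1) (V : ℕ → A) (hV : V (g + 1) = 0) (L : A → A) (B : ℕ → A → A)
    (hL : ∀ f, L f = d 1 (d 1 f) - V 1 * f)
    (hB : ∀ k f, B k f = 4 * d k (d 1 (d 1 f)) - 2 * (V 1 * d k f + d k (V 1 * f))
      - (V k * d 1 f + d 1 (V k * f)) - 4 * d (k + 1) f)
    (hLB : ∀ k, 1 ≤ k → k ≤ g → ∀ f, L (B k f) = B k (L f))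
    (hBB : ∀ k l, 1 ≤ k → k ≤ g → 1 ≤ l → l ≤ g → ∀ f, B k (B l f) = B l (B k f))
    {z : A} (hz : ∀ k, d k z = 0) {l : ℕ} (h1 : 1 ≤ l) (hl : l ≤ g + 1) :
    d l (genF (d 1) (V 1) z (genW g V z)) = 0 := by
  have four (Q : Derivation ℂ A A) : Q 4 = 0 := by exact_mod_cast Q.map_natCast 4
  have two (Q : Derivation ℂ A A) : Q 2 = 0 := by exact_mod_cast Q.map_natCast 2
  have lax k (h1 : 1 ≤ k) (hk : k ≤ g) := lax_first (d 1) (d k) (d (k + 1)) (hd _ _) (hd _ _) hx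
    (V 1) (V k) L (B k) hL (hB k) (hLB k h1 hk)
  have hu k (h1 : 1 ≤ k) (hk : k ≤ g + 1) : d k (V 1) = d 1 (V k) := by
    rcases Nat.lt_or_ge g k with h | h
    · obtain rfl : k = g + 1 := by omega
      simp [hdg, hV]
    · exact (lax k h1 h).1
  have zc k l (hk1 : 1 ≤ k) (hk : k ≤ g) (hl1 : 1 ≤ l) (hl : l ≤ g) :=
    lax_second (d 1) (d k) (d (k + 1)) (d l) (d (l + 1)) (hd _ _) (hd _ _) (hd _ _) (hd _ _)
      (hd _ _) (hd _ _) (hd _ _) (hd _ _) hx (V 1) (V k) (V l)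
      (hu k hk1 (by omega)) (hu l hl1 (by omega)) L (B k) (B l) hL (hB k) (hB l) (hLB k hk1 hk)
      (hLB l hl1 hl) (hBB k l hk1 hk hl1 hl)
  have hsymm k l (hk1 : 1 ≤ k) (hk : k ≤ g + 1) (hl1 : 1 ≤ l) (hl : l ≤ g) :
      d k (V l) = d l (V k) := by
    rcases Nat.lt_or_ge g k with h | h
    · obtain rfl : k = g + 1 := by omega
      simp [hdg, hV]
    · exact (zc k l hk1 h hl1 hl).1
  have hW k : d k (genW g V z) = -∑ i ∈ Finset.range g, z ^ (i + 1) * d k (V (i + 1)) := by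
    simp [genW, two, hz]
  have hstep l (hl1 : 1 ≤ l) (hl : l ≤ g) :
      2 * d l (genW g V z) = 2 * z * d (l + 1) (genW g V z)
        + z * (V l * d 1 (genW g V z) - genW g V z * d 1 (V l)) := by
    have hsum : ∑ i ∈ Finset.range g, z ^ (i + 1) * d l (V (i + 1))
        = ∑ i ∈ Finset.range g, z ^ (i + 2) * d l (V (i + 2)) + z * d 1 (V l) := by
      have := Finset.sum_range_succ (fun i => z ^ (i + 1) * d l (V (i + 1))) g
      rw [hV, map_zero, mul_zero, add_zero] at this
      rw [← this, Finset.sum_range_succ', hu l hl1 (by omega)]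
      simp
    have hterm : 2 * ∑ i ∈ Finset.range g, z ^ (i + 2) * d l (V (i + 2))
        = 2 * z * ∑ i ∈ Finset.range g, z ^ (i + 1) * d (l + 1) (V (i + 1))
          + z * (V l * ∑ i ∈ Finset.range g, z ^ (i + 1) * d 1 (V (i + 1))
            - (∑ i ∈ Finset.range g, z ^ (i + 1) * V (i + 1)) * d 1 (V l)) := by
      simp only [Finset.mul_sum, Finset.sum_mul, ← Finset.sum_add_distrib,
        ← Finset.sum_sub_distrib]
      refine Finset.sum_congr rfl fun i hi => ?_
      have hi := Finset.mem_range.1 hi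
      have e := (zc (i + 1) l (by omega) (by omega) hl1 hl).2
      rw [hsymm (i + 1 + 1) l (by omega) (by omega) hl1 hl] at e
      linear_combination z ^ (i + 2) * e
    rw [hW, hW, hW, hsum]
    simp only [genW]
    linear_combination -hterm
  have hode : 4 * d 1 (genW g V z) = z * d 1 (d 1 (d 1 (genW g V z)))
      - 4 * z * (V 1 * d 1 (genW g V z)) - 2 * z * (genW g V z * d 1 (V 1)) := by
    have hsum : ∑ i ∈ Finset.range g, z ^ (i + 1) * d 1 (V (i + 1))
        = ∑ i ∈ Finset.range g, z ^ (i + 2) * d 1 (V (i + 2)) + z * d 1 (V 1) := by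
      have := Finset.sum_range_succ (fun i => z ^ (i + 1) * d 1 (V (i + 1))) g
      rw [hV, map_zero, mul_zero, add_zero] at this
      rw [← this, Finset.sum_range_succ']
      simp
    have hterm : 4 * ∑ i ∈ Finset.range g, z ^ (i + 2) * d 1 (V (i + 2))
        = z * ∑ i ∈ Finset.range g, z ^ (i + 1) * d 1 (d 1 (d 1 (V (i + 1))))
          - 4 * z * (V 1 * ∑ i ∈ Finset.range g, z ^ (i + 1) * d 1 (V (i + 1)))
          - 2 * z * ((∑ i ∈ Finset.range g, z ^ (i + 1) * V (i + 1)) * d 1 (V 1)) := by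
      simp only [Finset.mul_sum, Finset.sum_mul, ← Finset.sum_sub_distrib]
      refine Finset.sum_congr rfl fun i hi => ?_
      have hi := Finset.mem_range.1 hi
      have e := (lax (i + 1) (by omega) (by omega)).2
      rw [hu _ (by omega) (by omega)] at e
      linear_combination z ^ (i + 2) * e
    have h3 : d 1 (d 1 (d 1 (genW g V z)))
        = -∑ i ∈ Finset.range g, z ^ (i + 1) * d 1 (d 1 (d 1 (V (i + 1)))) := by
      simp [genW, two, hz]
    rw [h3, hW, hsum]
    rw [hsum] at hterm
    simp only [genW]
    linear_combination -hterm
  have hexp k : d k (genF (d 1) (V 1) z (genW g V z)) =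
      2 * z * d 1 (genW g V z) * d 1 (d k (genW g V z))
      - 2 * z * (d 1 (d 1 (d k (genW g V z))) * genW g V z
        + d 1 (d 1 (genW g V z)) * d k (genW g V z))
      + 4 * (d k (V 1) * z * genW g V z ^ 2
        + 2 * (1 + V 1 * z) * genW g V z * d k (genW g V z)) := by
    simp only [genF, pow_two, Derivation.leibniz, smul_eq_mul, map_sub, map_add, two, four, hz,
      Derivation.map_one_eq_zero, hd k 1]
    ring
  induction hl using Nat.decreasingInduction with
  | self => simp [hdg]
  | of_succ l hl ih =>
    have ih := ih (by omega)
    have s0 := hstep l h1 (by omega)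
    have s1 := congrArg (d 1) s0
    have s2 := congrArg (d 1) s1
    have e := (lax l h1 (by omega)).2
    rw [hu _ (by omega) (by omega)] at e
    rw [hexp, hu _ (by omega) (by omega)] at ih ⊢
    simp only [Derivation.leibniz, smul_eq_mul, map_sub, map_add, map_zero, two, hz] at s1 s2
    generalize genW g V z = W at *
    refine eq_zero_of_natCast_mul_eq_zero 2 two_ne_zero ?_
    push_cast
    linear_combination 2 * z * ih + 2 * z * d 1 W * s1 - 2 * z * W * s2
      + (-2 * z * d 1 (d 1 W) + 8 * (1 + V 1 * z) * W) * s0 - 2 * z ^ 2 * W ^ 2 * e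
      + 2 * z * W * V l * hode

/-- The complex algebra of holomorphic functions on `Ω`. -/
def holo (g : ℕ) (Ω : Set (Fin g → ℂ)) : Subalgebra ℂ (Ω → ℂ) where
  carrier := {f | ∃ F : (Fin g → ℂ) → ℂ, AnalyticOnNhd ℂ F Ω ∧ ∀ t : Ω, F t = f t}
  mul_mem' := by
    rintro _ _ ⟨F, hF, h⟩ ⟨G, hG, h'⟩
    exact ⟨F * G, hF.mul hG, fun t => by simp [h, h']⟩
  add_mem' := by
    rintro _ _ ⟨F, hF, h⟩ ⟨G, hG, h'⟩
    exact ⟨F + G, hF.add hG, fun t => by simp [h, h']⟩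
  algebraMap_mem' c := ⟨fun _ => c, analyticOnNhd_const, fun _ => rfl⟩

/-- The restriction to `Ω` of a function analytic on `Ω`. -/
def toHolo {g : ℕ} {Ω : Set (Fin g → ℂ)} (F : (Fin g → ℂ) → ℂ) (hF : AnalyticOnNhd ℂ F Ω) :
    holo g Ω :=
  ⟨fun t => F t, F, hF, fun _ => rfl⟩

section holo

variable {g : ℕ} {Ω : Set (Fin g → ℂ)}

lemma exists_toHolo_eq (a : holo g Ω) : ∃ F, ∃ hF : AnalyticOnNhd ℂ F Ω, toHolo F hF = a := by
  obtain ⟨F, hF, h⟩ := a.2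
  exact ⟨F, hF, Subtype.ext (funext h)⟩

lemma toHolo_eq_iff {F G : (Fin g → ℂ) → ℂ} {hF : AnalyticOnNhd ℂ F Ω}
    {hG : AnalyticOnNhd ℂ G Ω} : toHolo F hF = toHolo G hG ↔ Set.EqOn F G Ω :=
  ⟨fun h t ht => congrFun (congrArg Subtype.val h) ⟨t, ht⟩,
    fun h => Subtype.ext (funext fun t => h t.2)⟩

lemma pd_apply_of_le {m : ℕ} (h : 1 ≤ m) (h' : m - 1 < g) (f : (Fin g → ℂ) → ℂ) :
    pd g m f = fun t => fderiv ℂ f t (Pi.single (⟨m - 1, h'⟩ : Fin g) 1) := by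
  funext t
  rw [pd, dif_pos ⟨h, h'⟩]

lemma pd_eq_zero {m : ℕ} (h : ¬(1 ≤ m ∧ m - 1 < g)) (f : (Fin g → ℂ) → ℂ) : pd g m f = 0 := by
  funext t
  rw [pd, dif_neg h, Pi.zero_apply]

lemma AnalyticOnNhd.pd {F : (Fin g → ℂ) → ℂ} (hF : AnalyticOnNhd ℂ F Ω) (m : ℕ) :
    AnalyticOnNhd ℂ (pd g m F) Ω := by
  by_cases h : 1 ≤ m ∧ m - 1 < g
  · rw [pd_apply_of_le h.1 h.2]
    exact (ContinuousLinearMap.apply ℂ ℂ (Pi.single (⟨m - 1, h.2⟩ : Fin g) (1 : ℂ))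
      ).comp_analyticOnNhd hF.fderiv
  · rw [pd_eq_zero h]
    exact analyticOnNhd_const

lemma pd_congr (hΩ : IsOpen Ω) {F G : (Fin g → ℂ) → ℂ} (h : Set.EqOn F G Ω) (m : ℕ) :
    Set.EqOn (pd g m F) (pd g m G) Ω := fun t ht => by
  rw [pd, pd, (h.eventuallyEq_of_mem (hΩ.mem_nhds ht)).fderiv_eq]

lemma pd_add {F G : (Fin g → ℂ) → ℂ} (hF : AnalyticOnNhd ℂ F Ω) (hG : AnalyticOnNhd ℂ G Ω)
    (m : ℕ) : Set.EqOn (pd g m (F + G)) (pd g m F + pd g m G) Ω := fun t ht => by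
  by_cases h : 1 ≤ m ∧ m - 1 < g
  · simp [pd_apply_of_le h.1 h.2,
      fderiv_add (hF t ht).differentiableAt (hG t ht).differentiableAt]
  · simp [pd_eq_zero h]

lemma pd_smul {F : (Fin g → ℂ) → ℂ} (hF : AnalyticOnNhd ℂ F Ω) (c : ℂ)
    (m : ℕ) : Set.EqOn (pd g m (c • F)) (c • pd g m F) Ω := fun t ht => by
  by_cases h : 1 ≤ m ∧ m - 1 < g
  · simp [pd_apply_of_le h.1 h.2, fderiv_const_smul (hF t ht).differentiableAt]
  · simp [pd_eq_zero h]

lemma pd_mul {F G : (Fin g → ℂ) → ℂ} (hF : AnalyticOnNhd ℂ F Ω) (hG : AnalyticOnNhd ℂ G Ω)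
    (m : ℕ) : Set.EqOn (pd g m (F * G)) (F * pd g m G + G * pd g m F) Ω := fun t ht => by
  by_cases h : 1 ≤ m ∧ m - 1 < g
  · simp [pd_apply_of_le h.1 h.2,
      fderiv_mul (hF t ht).differentiableAt (hG t ht).differentiableAt]
  · simp [pd_eq_zero h]

lemma pd_comm {F : (Fin g → ℂ) → ℂ} (hF : AnalyticOnNhd ℂ F Ω) (k l : ℕ) :
    Set.EqOn (pd g k (pd g l F)) (pd g l (pd g k F)) Ω := fun t ht => by
  by_cases hk : 1 ≤ k ∧ k - 1 < g
  · by_cases hl : 1 ≤ l ∧ l - 1 < g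
    · have e := (hF.fderiv t ht).differentiableAt
      simp only [pd_apply_of_le hk.1 hk.2, pd_apply_of_le hl.1 hl.2]
      rw [fderiv_clm_apply e (by fun_prop), fderiv_clm_apply e (by fun_prop)]
      have := ((hF t ht).contDiffAt (n := ⊤)).isSymmSndFDerivAt_of_omega
        (Pi.single (⟨k - 1, hk.2⟩ : Fin g) 1) (Pi.single (⟨l - 1, hl.2⟩ : Fin g) 1)
      simpa using this
    · rw [pd_eq_zero hl, pd_eq_zero hl]
      simp [pd_apply_of_le hk.1 hk.2]
  · rw [pd_eq_zero hk, pd_eq_zero hk]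
    by_cases hl : 1 ≤ l ∧ l - 1 < g
    · simp [pd_apply_of_le hl.1 hl.2]
    · simp [pd_eq_zero hl]

/-- The underlying function of `holoDeriv`. -/
def holoPd (m : ℕ) (a : holo g Ω) : holo g Ω :=
  toHolo (pd g m a.2.choose) (a.2.choose_spec.1.pd m)

lemma holoPd_toHolo (hΩ : IsOpen Ω) (m : ℕ) {F : (Fin g → ℂ) → ℂ} (hF : AnalyticOnNhd ℂ F Ω) :
    holoPd m (toHolo F hF) = toHolo (pd g m F) (hF.pd m) :=
  toHolo_eq_iff.2 (pd_congr hΩ (fun t ht => (toHolo F hF).2.choose_spec.2 ⟨t, ht⟩) m)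

/-- The partial derivative with respect to the `m`-th coordinate, as a derivation of the algebra of
holomorphic functions. -/
def holoDeriv (hΩ : IsOpen Ω) (m : ℕ) : Derivation ℂ (holo g Ω) (holo g Ω) :=
  Derivation.mk'
    { toFun := holoPd m
      map_add' := fun a b => by
        obtain ⟨F, hF, rfl⟩ := exists_toHolo_eq a
        obtain ⟨G, hG, rfl⟩ := exists_toHolo_eq b
        rw [holoPd_toHolo hΩ, holoPd_toHolo hΩ]
        exact (holoPd_toHolo hΩ m (hF.add hG)).trans (toHolo_eq_iff.2 (pd_add hF hG m) :
          _ = toHolo _ ((hF.pd m).add (hG.pd m)))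
      map_smul' := fun c a => by
        obtain ⟨F, hF, rfl⟩ := exists_toHolo_eq a
        rw [holoPd_toHolo hΩ]
        exact (holoPd_toHolo hΩ m (hF.const_smul (c := c))).trans
          (toHolo_eq_iff.2 (pd_smul hF c m) : _ = toHolo _ (hF.pd m).const_smul) }
    fun a b => by
      obtain ⟨F, hF, rfl⟩ := exists_toHolo_eq a
      obtain ⟨G, hG, rfl⟩ := exists_toHolo_eq b
      simp only [LinearMap.coe_mk, AddHom.coe_mk, holoPd_toHolo hΩ]
      exact (holoPd_toHolo hΩ m (hF.mul hG)).trans (toHolo_eq_iff.2 (pd_mul hF hG m) :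
        _ = toHolo _ ((hF.mul (hG.pd m)).add (hG.mul (hF.pd m))))

lemma holoDeriv_toHolo (hΩ : IsOpen Ω) (m : ℕ) {F : (Fin g → ℂ) → ℂ}
    (hF : AnalyticOnNhd ℂ F Ω) : holoDeriv hΩ m (toHolo F hF) = toHolo (pd g m F) (hF.pd m) :=
  holoPd_toHolo hΩ m hF

lemma holoDeriv_comm (hΩ : IsOpen Ω) (k l : ℕ) (a : holo g Ω) :
    holoDeriv hΩ k (holoDeriv hΩ l a) = holoDeriv hΩ l (holoDeriv hΩ k a) := by
  obtain ⟨F, hF, rfl⟩ := exists_toHolo_eq a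
  simp only [holoDeriv_toHolo]
  exact toHolo_eq_iff.2 (pd_comm hF k l)

lemma holoDeriv_eq_zero (hΩ : IsOpen Ω) {m : ℕ} (hm : g < m) :
    holoDeriv (g := g) hΩ m = 0 := by
  ext a : 1
  obtain ⟨F, hF, rfl⟩ := exists_toHolo_eq a
  rw [holoDeriv_toHolo, Derivation.zero_apply]
  refine Subtype.ext (funext fun t => ?_)
  exact congrFun (pd_eq_zero (by omega) F) t

lemma exists_holoDeriv_eq_one (hΩ : IsOpen Ω) (hg : 1 ≤ g) :
    ∃ x : holo g Ω, holoDeriv hΩ 1 x = 1 := by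
  let p : (Fin g → ℂ) →L[ℂ] ℂ := ContinuousLinearMap.proj ⟨1 - 1, by omega⟩
  have hp : AnalyticOnNhd ℂ p Ω := fun t _ => p.analyticAt t
  refine ⟨toHolo p hp, ?_⟩
  rw [holoDeriv_toHolo]
  refine Subtype.ext (funext fun t => ?_)
  change pd g 1 p t = 1
  rw [pd_apply_of_le le_rfl (by omega)]
  simp [p]

lemma eq_of_holoDeriv_eq_zero (hΩ : IsOpen Ω) (hconn : IsPreconnected Ω) {a : holo g Ω}
    (ha : ∀ m, 1 ≤ m → m ≤ g → holoDeriv hΩ m a = 0) (s t : Ω) : a.1 s = a.1 t := by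
  obtain ⟨F, hF, rfl⟩ := exists_toHolo_eq a
  refine hΩ.is_const_of_fderiv_eq_zero (𝕜 := ℂ) hconn hF.differentiableOn (fun y hy => ?_) s.2 t.2
  refine ContinuousLinearMap.coe_injective (LinearMap.pi_ext' fun i => LinearMap.ext_ring ?_)
  have := congrFun (congrArg Subtype.val (ha (i + 1) (by omega) (by omega))) ⟨y, hy⟩
  rw [holoDeriv_toHolo] at this
  change pd g (i + 1) F y = 0 at this
  rw [pd_apply_of_le (by omega) (by omega)] at this
  simpa using this

end holo

lemma evalBeta_lam (g : ℕ) (hg : 1 ≤ g) (v : ℕ → (Fin g → ℂ) → ℂ) (t : Fin g → ℂ) (m : ℕ) :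
    evalBeta g v t (lam g m) = 1 / 4 * (Polynomial.X * (cpoly g v 2 t) ^ 2
      + 2 * Polynomial.X * cpoly g v 3 t * (1 - cpoly g v 1 t)
      + 4 * (1 + Polynomial.C (v 1 t) * Polynomial.X) * (1 - cpoly g v 1 t) ^ 2).coeff (m + 1) := by
  set φ := MvPolynomial.eval
    (fun w : Fin 3 × Fin g => betaf g v ((w.1 : ℕ) + 1) ((w.2 : ℕ) + 1) t) with hφ
  have hb i k (hi : 1 ≤ i) (hi' : i ≤ 3) (hk : 1 ≤ k) (hk' : k ≤ g) :
      φ (bb g i k) = betaf g v i k t := by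
    rw [bb, dif_pos ⟨hi, hi', hk, hk'⟩, hφ, MvPolynomial.eval_X]
    simp only
    rw [Nat.sub_add_cancel hi, Nat.sub_add_cancel hk]
  have hc i (hi : 1 ≤ i) (hi' : i ≤ 3) : (Bcoef g i).map φ = cpoly g v i t := by
    rw [Bcoef, cpoly, Polynomial.map_sum]
    refine Finset.sum_congr rfl fun k hk => ?_
    obtain ⟨h1, h2⟩ := Finset.mem_Icc.1 hk
    simp [hb i k hi hi' h1 h2, betaf]
  have hF : (Fg g).map φ = Polynomial.X * (cpoly g v 2 t) ^ 2
      + 2 * Polynomial.X * cpoly g v 3 t * (1 - cpoly g v 1 t)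
      + 4 * (1 + Polynomial.C (v 1 t) * Polynomial.X) * (1 - cpoly g v 1 t) ^ 2 := by
    have : (2 : Polynomial ℂ) * Polynomial.C (φ (bb g 1 1)) = Polynomial.C (v 1 t) := by
      rw [hb 1 1 le_rfl (by norm_num) le_rfl hg, ← Polynomial.C_ofNat, ← Polynomial.C_mul]
      simp [betaf]
    simp [Fg, hc, this]
  rw [← hF, Polynomial.coeff_map, evalBeta, lam, ← hφ, MvPolynomial.smul_eq_C_mul, map_mul]
  simp [hφ]

/-- If the operators commute, the generating polynomial of the parameters is constant on `Ω`. -/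
lemma generatingPolynomial_eq_of_opsCommute (g : ℕ) (hg : 1 ≤ g) (Ω : Set (Fin g → ℂ))
    (hΩ : IsOpen Ω) (hconn : IsConnected Ω) (v : ℕ → (Fin g → ℂ) → ℂ)
    (hv : ∀ m, 1 ≤ m → m ≤ g → AnalyticOnNhd ℂ (v m) Ω) (hcomm : OpsCommute g Ω v)
    (P : (Fin g → ℂ) → Polynomial ℂ)
    (hP : ∀ t, P t = Polynomial.X * (cpoly g v 2 t) ^ 2
      + 2 * Polynomial.X * cpoly g v 3 t * (1 - cpoly g v 1 t)
      + 4 * (1 + Polynomial.C (v 1 t) * Polynomial.X) * (1 - cpoly g v 1 t) ^ 2)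
    {t t' : Fin g → ℂ} (ht : t ∈ Ω) (ht' : t' ∈ Ω) : P t = P t' := by
  refine Polynomial.funext fun ξ => ?_
  obtain ⟨x, hx⟩ := exists_holoDeriv_eq_one hΩ hg
  let V : ℕ → holo g Ω := fun m =>
    if h : 1 ≤ m ∧ m ≤ g then toHolo (v m) (hv m h.1 h.2) else 0
  have hVm m (h1 : 1 ≤ m) (h2 : m ≤ g) : V m = toHolo (v m) (hv m h1 h2) := dif_pos ⟨h1, h2⟩
  let d := holoDeriv (g := g) hΩ
  let L : holo g Ω → holo g Ω := fun f => d 1 (d 1 f) - V 1 * f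
  let B : ℕ → holo g Ω → holo g Ω := fun k f => 4 * d k (d 1 (d 1 f))
    - 2 * (V 1 * d k f + d k (V 1 * f)) - (V k * d 1 f + d 1 (V k * f)) - 4 * d (k + 1) f
  have hLa {F} (hF : AnalyticOnNhd ℂ F Ω) : AnalyticOnNhd ℂ (Lfun g v F) Ω :=
    ((hF.pd 1).pd 1).sub ((hv 1 le_rfl hg).mul hF)
  have hBa k (h1 : 1 ≤ k) (hk : k ≤ g) {F} (hF : AnalyticOnNhd ℂ F Ω) :
      AnalyticOnNhd ℂ (Bfun g v k F) Ω := by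
    have hu := hv 1 le_rfl hg
    have hk := hv k h1 hk
    exact ((((((hF.pd 1).pd 1).pd k).sub ((hu.mul (hF.pd k)).add
      ((hu.mul hF).pd k)).const_smul)).sub ((hk.mul (hF.pd 1)).add
      ((hk.mul hF).pd 1)).const_smul).sub (hF.pd (k + 1))
  have hL {F} (hF : AnalyticOnNhd ℂ F Ω) : L (toHolo F hF) = toHolo (Lfun g v F) (hLa hF) := by
    simp only [L, d, holoDeriv_toHolo, hVm 1 le_rfl hg]
    rfl
  have hB k (h1 : 1 ≤ k) (hk : k ≤ g) {F} (hF : AnalyticOnNhd ℂ F Ω) :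
      B k (toHolo F hF) = (4 : ℂ) • toHolo (Bfun g v k F) (hBa k h1 hk hF) := by
    have e i (h1 : 1 ≤ i) (hi : i ≤ g) j : d j (V i * toHolo F hF)
        = toHolo (pd g j (v i * F)) (((hv i h1 hi).mul hF).pd j) := by
      rw [hVm i h1 hi]
      exact holoDeriv_toHolo hΩ j ((hv i h1 hi).mul hF)
    simp only [B, e 1 le_rfl hg, e k h1 hk]
    simp only [d, holoDeriv_toHolo, hVm 1 le_rfl hg, hVm k h1 hk]
    refine Subtype.ext (funext fun s => ?_)
    change 4 * _ - 2 * (_ * _ + _) - (_ * _ + _) - 4 * _ = (4 : ℂ) * Bfun g v k F s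
    simp only [Bfun, Pi.sub_apply, Pi.smul_apply, Pi.add_apply, Pi.mul_apply, smul_eq_mul, toHolo]
    ring
  have hLsmul (c : ℂ) f : L (c • f) = c • L f := by
    simp only [L, Derivation.map_smul, mul_smul_comm, smul_sub]
  have hBsmul k (c : ℂ) f : B k (c • f) = c • B k f := by
    simp only [B, Derivation.map_smul, mul_smul_comm, ← smul_sub, ← smul_add]
  have hconst : ∀ l, 1 ≤ l → l ≤ g →
      d l (genF (d 1) (V 1) (algebraMap ℂ _ ξ) (genW g V (algebraMap ℂ _ ξ))) = 0 := by
    intro l h1 hl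
    refine derivation_genF_eq_zero d (holoDeriv_comm hΩ) (holoDeriv_eq_zero hΩ (by omega)) hx V
      (dif_neg (by omega)) L B (fun _ => rfl) (fun _ _ => rfl) ?_ ?_
      (fun k => (d k).map_algebraMap ξ) h1 (by omega)
    · intro k h1 hk f
      obtain ⟨F, hF, rfl⟩ := exists_toHolo_eq f
      rw [hB k h1 hk, hLsmul, hL, hL, hB k h1 hk]
      exact congrArg _ (toHolo_eq_iff.2 (hcomm F hF k k h1 hk h1 hk).1)
    · intro k l hk1 hk hl1 hl f
      obtain ⟨F, hF, rfl⟩ := exists_toHolo_eq f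
      rw [hB k hk1 hk, hBsmul, hB l hl1 hl, hBsmul, hB k hk1 hk, hB l hl1 hl]
      exact congrArg _ (congrArg _ (toHolo_eq_iff.2 (hcomm F hF k l hk1 hk hl1 hl).2))
  have hval (s : Ω) :
      (genF (d 1) (V 1) (algebraMap ℂ _ ξ) (genW g V (algebraMap ℂ _ ξ))).1 s
        = 4 * (P s).eval ξ := by
    let ev : holo g Ω →+* ℂ := (Pi.evalRingHom (fun _ => ℂ) s).comp (holo g Ω).val.toRingHom
    have hz : ev (algebraMap ℂ _ ξ) = ξ := rfl
    have two : (d 1) 2 = 0 := by exact_mod_cast (d 1).map_natCast 2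
    have hsum (a : ℕ → holo g Ω) (i : ℕ)
        (ha : ∀ k, 1 ≤ k → k ≤ g → ev (a k) = ((pd g 1)^[i - 1] (v k)) s) :
        ev (∑ k ∈ Finset.range g, algebraMap ℂ _ ξ ^ (k + 1) * a (k + 1))
          = 2 * (cpoly g v i s).eval ξ := by
      rw [map_sum, cpoly, Polynomial.eval_finsetSum, Finset.mul_sum, Finset.range_eq_Ico,
        Finset.sum_Ico_add' (fun k => ev (algebraMap ℂ _ ξ ^ k * a k)) 0 g 1]
      refine Finset.sum_congr (by ext; simp) fun k hk => ?_
      obtain ⟨h1, h2⟩ := Finset.mem_Icc.1 hk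
      rw [map_mul, map_pow, hz, ha k h1 h2]
      simp
      ring
    have e0 : ev (genW g V (algebraMap ℂ _ ξ)) = 2 * (1 - (cpoly g v 1 s).eval ξ) := by
      rw [genW, map_sub, hsum V 1 fun k h1 hk => by rw [hVm k h1 hk]; rfl, map_ofNat]
      ring
    have e1 : ev (d 1 (genW g V (algebraMap ℂ _ ξ))) = -(2 * (cpoly g v 2 s).eval ξ) := by
      rw [← hsum (fun k => d 1 (V k)) 2 fun k h1 hk => by
        simp only [d, hVm k h1 hk, holoDeriv_toHolo]; rfl]
      simp [genW, two, ← map_pow]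
    have e2 : ev (d 1 (d 1 (genW g V (algebraMap ℂ _ ξ)))) = -(2 * (cpoly g v 3 s).eval ξ) := by
      rw [← hsum (fun k => d 1 (d 1 (V k))) 3 fun k h1 hk => by
        simp only [d, hVm k h1 hk, holoDeriv_toHolo]; rfl]
      simp [genW, two, ← map_pow]
    have eV : ev (V 1) = v 1 s := by rw [hVm 1 le_rfl hg]; rfl
    change ev (genF _ _ _ _) = _
    rw [hP, genF]
    simp only [map_add, map_sub, map_mul, map_pow, map_one, map_ofNat, e0, e1, e2, eV, hz]
    simp
    ring
  have h : (4 : ℂ) * (P t).eval ξ = 4 * (P t').eval ξ :=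
    (hval ⟨t, ht⟩).symm.trans
      ((eq_of_holoDeriv_eq_zero hΩ hconn.isPreconnected hconst _ _).trans (hval ⟨t', ht'⟩))
  exact mul_left_cancel₀ (by norm_num : (4 : ℂ) ≠ 0) h

/-- if the operators L, B₃, …, B_{2g+1} commute, then t ↦ ρ_g(β(t)),
i.e. t ↦ (λ₄(β(t)), …, λ_{4g+2}(β(t))), is constant on Ω; moreover if μ₄, …, μ_{4g+2}
are constants satisfying the generating identity on Ω, then λ_{2m+2}(β) ≡ μ_{2m+2} on Ω
for every 1 ≤ m ≤ 2g.  (Here `μ m` denotes μ_{2m+2} and `v m` denotes v_{2m}.) -/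
theorem stmt19 (g : ℕ) (hg : 1 ≤ g) (Ω : Set (Fin g → ℂ)) (hΩ : IsOpen Ω)
    (hconn : IsConnected Ω)
    (v : ℕ → (Fin g → ℂ) → ℂ) (hv : ∀ m, 1 ≤ m → m ≤ g → AnalyticOnNhd ℂ (v m) Ω)
    (hcomm : OpsCommute g Ω v) :
    (∀ m, 1 ≤ m → m ≤ 2 * g → ∀ t ∈ Ω, ∀ t' ∈ Ω,
      evalBeta g v t (lam g m) = evalBeta g v t' (lam g m)) ∧
    (∀ μ : ℕ → ℂ, GenIdent g Ω v μ →
      ∀ m, 1 ≤ m → m ≤ 2 * g → ∀ t ∈ Ω, evalBeta g v t (lam g m) = μ m) := by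
  refine ⟨fun m _ _ t ht t' ht' => ?_, fun μ hμ m hm1 hm t ht => ?_⟩
  · rw [evalBeta_lam g hg, evalBeta_lam g hg,
      generatingPolynomial_eq_of_opsCommute g hg Ω hΩ hconn v hv hcomm _ (fun _ => rfl) ht ht']
  · rw [evalBeta_lam g hg, hμ t ht, ← Polynomial.C_ofNat, Polynomial.coeff_add,
      Polynomial.coeff_C_mul, Polynomial.finsetSum_coeff, Polynomial.coeff_C_succ]
    simp only [Polynomial.coeff_C_mul_X_pow, add_left_inj]
    rw [Finset.sum_ite_eq, if_pos (Finset.mem_Icc.2 ⟨hm1, hm⟩)]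
    ring

end
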